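/- arXiv:2506.04299 — 6 statements merged into one kernel-verified Lean document; each statement's English description precedes it below -/
import Mathlib

section
/- Let (x, R, z) be a Markov triple and let u be the edge sequence of (x, R, z). Then for every integer n, (u(n))² + R² + (u(n+1))² = 3·R·u(n)·u(n+1); that is, every pair of consecutive terms of the edge sequence together with R solves the Markov equation, for all integer indices n (positive indices giving one edge of the region and negative indices the other). -/
/-- If (x, R, z) is a Markov triple and u is the edge sequence of (x, R, z)
(u(0) = x, u(1) = z, u(n+1) = 3·R·u(n) − u(n−1) for all n ∈ ℤ), then every pair of
consecutive terms of u together with R solves the Markov equation, for all integer n. -/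
theorem markov_edge_sequence (x R z : ℤ) (hx : 0 < x) (hR : 0 < R) (hz : 0 < z)
    (h : x ^ 2 + R ^ 2 + z ^ 2 = 3 * x * R * z)
    (u : ℤ → ℤ) (hu0 : u 0 = x) (hu1 : u 1 = z)
    (hrec : ∀ n : ℤ, u (n + 1) = 3 * R * u n - u (n - 1)) :
    ∀ n : ℤ, (u n) ^ 2 + R ^ 2 + (u (n + 1)) ^ 2 = 3 * R * u n * u (n + 1) := by
  intro n
  induction n using Int.induction_on with
  | zero =>
    rw [zero_add, hu0, hu1]
    linear_combination h
  | succ k ih =>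
    have hk := hrec ((k : ℤ) + 1)
    rw [add_sub_cancel_right] at hk
    rw [hk]
    linear_combination ih
  | pred k ih =>
    have hk := hrec (-(k : ℤ))
    rw [hk] at ih
    rw [sub_add_cancel]
    linear_combination ih
end

section
/- Let (x, R, z) be a Markov triple and let u be the edge sequence of (x, R, z). Then for every integer n, (u(n+1) − u(n−1))² − ((3R)² − 4)·(u(n))² = −(2R)². That is, the edge sequence u(n) together with its associated companion sequence v(n) = u(n+1) − u(n−1) satisfies the Pell equation v² − D(R)·u² = −4R² with discriminant D(R) = 9R² − 4, for all integer n. -/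
/-- The quadratic form `a² + b² - k * a * b` is constant along consecutive terms of a two-sided
solution of the recurrence `u (n + 1) = k * u n - u (n - 1)`. -/
theorem sq_add_sq_sub_mul_eq_of_recurrence {A : Type*} [CommRing A] (k : A) (u : ℤ → A)
    (hu : ∀ n : ℤ, u (n + 1) = k * u n - u (n - 1)) (n : ℤ) :
    u n ^ 2 + u (n + 1) ^ 2 - k * u n * u (n + 1) = u 0 ^ 2 + u 1 ^ 2 - k * u 0 * u 1 := by
  induction n using Int.induction_on with
  | zero => simp
  | succ i ih =>
    have hi := hu (i + 1)
    rw [add_sub_cancel_right] at hi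
    rw [← ih, hi]
    ring
  | pred i ih =>
    rw [← ih, sub_add_cancel, hu (-i)]
    ring

/-- If (x, R, z) is a Markov triple and u is its edge sequence, then the
companion sequence v(n) = u(n+1) − u(n−1) satisfies the Pell equation
v(n)² − D(R)·u(n)² = −(2R)² with discriminant D(R) = (3R)² − 4, for all integer n. -/
theorem edge_sequence_pell (x R z : ℤ) (hx : 0 < x) (hR : 0 < R) (hz : 0 < z)
    (h : x ^ 2 + R ^ 2 + z ^ 2 = 3 * x * R * z)
    (u : ℤ → ℤ) (hu0 : u 0 = x) (hu1 : u 1 = z)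
    (hurec : ∀ n : ℤ, u (n + 1) = 3 * R * u n - u (n - 1)) :
    ∀ n : ℤ, (u (n + 1) - u (n - 1)) ^ 2 - ((3 * R) ^ 2 - 4) * (u n) ^ 2
      = -(2 * R) ^ 2 := by
  intro n
  have hn := sq_add_sq_sub_mul_eq_of_recurrence (3 * R) u hurec n
  rw [hu0, hu1] at hn
  have hprev : u (n - 1) = 3 * R * u n - u (n + 1) := by linear_combination hurec n
  rw [hprev]
  linear_combination 4 * hn + 4 * h
end

section
/- Let (x, R, z) be a Markov triple. Then the Pell equation K² − (9R² − 4)·J² = −4R² has infinitely many solutions in positive integers (K, J); in particular, if R is a Markov number then this Pell equation is solvable in positive integers. -/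
/-- Vieta jumping with `R` fixed produces solutions of the Markov equation with arbitrarily
large remaining entries. -/
theorem exists_markov_triple_gt {x R z : ℤ} (hx : 0 < x) (hR : 0 < R) (hxz : x ≤ z)
    (h : x ^ 2 + R ^ 2 + z ^ 2 = 3 * x * R * z) (n : ℕ) :
    ∃ a b : ℤ, 0 < a ∧ a ≤ b ∧ (n : ℤ) < b ∧ a ^ 2 + R ^ 2 + b ^ 2 = 3 * a * R * b := by
  induction n with
  | zero => exact ⟨x, z, hx, hxz, by push_cast; linarith, h⟩
  | succ n ih =>
    obtain ⟨a, b, ha, hab, hnb, hm⟩ := ih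
    have hRb : b ≤ R * b := le_mul_of_one_le_left (by linarith) hR
    exact ⟨b, 3 * R * b - a, by linarith, by linarith, by push_cast; linarith,
      by linear_combination hm⟩

/-- If (x, R, z) is a Markov triple, then the Pell equation
K² − (9R² − 4)·J² = −4R² has infinitely many solutions in positive integers (K, J);
in particular this Pell equation is solvable whenever R is a Markov number. -/
theorem markov_pell_infinitely_many_solutions (x R z : ℤ)
    (hx : 0 < x) (hR : 0 < R) (hz : 0 < z)
    (h : x ^ 2 + R ^ 2 + z ^ 2 = 3 * x * R * z) :
    {p : ℤ × ℤ | 0 < p.1 ∧ 0 < p.2 ∧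
      p.1 ^ 2 - (9 * R ^ 2 - 4) * p.2 ^ 2 = -4 * R ^ 2}.Infinite := by
  have key : ∀ n : ℕ, ∃ a b : ℤ, 0 < a ∧ a ≤ b ∧ (n : ℤ) < b ∧
      a ^ 2 + R ^ 2 + b ^ 2 = 3 * a * R * b := by
    rcases le_total x z with hxz | hzx
    · exact exists_markov_triple_gt hx hR hxz h
    · exact exists_markov_triple_gt hz hR hzx (by linear_combination h)
  apply Set.Infinite.of_image Prod.snd
  refine Set.infinite_of_forall_exists_gt fun m => ?_
  obtain ⟨a, b, ha, hab, hmb, hm⟩ := key m.toNat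
  have hRb : b ≤ R * b := le_mul_of_one_le_left (by linarith) hR
  refine ⟨b, ⟨(3 * R * b - 2 * a, b), ⟨?_, ?_, ?_⟩, rfl⟩, lt_of_le_of_lt m.self_le_toNat hmb⟩
  · change 0 < 3 * R * b - 2 * a
    linarith
  · exact ha.trans_le hab
  · linear_combination 4 * hm
end

section
/- Let (x, R, z) be a Markov triple with R even, and let u be the edge sequence of (x, R, z). Then u(n) is odd for every integer n; that is, a region headed by a triplet of parity type {odd, even, odd} produces only region numbers of odd parity along both of its edges. -/
/-- A sum of three squares divisible by twice the product has all terms even. -/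
theorem even_of_sum_sq_eq_two_mul {a b c m : ℤ}
    (h : a ^ 2 + b ^ 2 + c ^ 2 = 2 * m * (a * b * c)) : Even a ∧ Even b ∧ Even c := by
  have key : ∀ a b c m : ZMod 4, a ^ 2 + b ^ 2 + c ^ 2 = 2 * m * (a * b * c) →
      2 * a = 0 ∧ 2 * b = 0 ∧ 2 * c = 0 := by decide
  have even_of (t : ℤ) (ht : 2 * (t : ZMod 4) = 0) : Even t := by
    have hd : ((4 : ℕ) : ℤ) ∣ 2 * t := (ZMod.intCast_zmod_eq_zero_iff_dvd _ 4).1 (by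
      push_cast; exact ht)
    rw [Int.even_iff]
    omega
  obtain ⟨ha, hb, hc⟩ := key a b c m (by exact_mod_cast congrArg (Int.cast : ℤ → ZMod 4) h)
  exact ⟨even_of a ha, even_of b hb, even_of c hc⟩

/-- The equation `a² + b² + c² = 2mabc` has only the trivial solution, by descent. -/
theorem eq_zero_of_sum_sq_eq_two_mul {a b c m : ℤ}
    (h : a ^ 2 + b ^ 2 + c ^ 2 = 2 * m * (a * b * c)) : a = 0 := by
  induction hN : a.natAbs using Nat.strong_induction_on generalizing a b c m with
  | _ N ih =>
    by_contra ha
    obtain ⟨⟨i, rfl⟩, ⟨j, rfl⟩, ⟨k, rfl⟩⟩ := even_of_sum_sq_eq_two_mul h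
    have hi : i = 0 := ih i.natAbs (by omega)
      (show i ^ 2 + j ^ 2 + k ^ 2 = 2 * (2 * m) * (i * j * k) by linarith) rfl
    omega

/-- In a Markov triple with even middle entry the outer entries are odd. -/
theorem odd_of_markov_of_even {x R z : ℤ} (hx : x ≠ 0)
    (h : x ^ 2 + R ^ 2 + z ^ 2 = 3 * x * R * z) (hR : Even R) : Odd x ∧ Odd z := by
  have hpar : Even (x ^ 2 + R ^ 2 + z ^ 2) := by
    rw [h]
    exact ((hR.mul_left _).mul_right _)
  have hxz : Even x ↔ Even z := by
    simpa [Int.even_add, Int.even_pow, hR] using hpar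
  have hxo : ¬ Even x := by
    intro hxe
    obtain ⟨i, rfl⟩ := hxe
    obtain ⟨k, rfl⟩ := hxz.1 ⟨i, rfl⟩
    obtain ⟨j, rfl⟩ := hR
    have hi : i = 0 := eq_zero_of_sum_sq_eq_two_mul (b := j) (c := k) (m := 3) (by linarith)
    omega
  exact ⟨Int.not_even_iff_odd.1 hxo, Int.not_even_iff_odd.1 (mt hxz.2 hxo)⟩


/-- If (x, R, z) is a Markov triple with R even (parity type
{odd, even, odd}) and u is its edge sequence, then u(n) is odd for every integer n. -/
theorem markov_even_region_edge_odd (x R z : ℤ) (hx : 0 < x) (hR : 0 < R) (hz : 0 < z)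
    (h : x ^ 2 + R ^ 2 + z ^ 2 = 3 * x * R * z) (hReven : Even R)
    (u : ℤ → ℤ) (hu0 : u 0 = x) (hu1 : u 1 = z)
    (hurec : ∀ n : ℤ, u (n + 1) = 3 * R * u n - u (n - 1)) :
    ∀ n : ℤ, Odd (u n) := by
  obtain ⟨hxo, hzo⟩ := odd_of_markov_of_even hx.ne' h hReven
  have hodd (n : ℤ) : Odd (u (n + 1)) ↔ Odd (u (n - 1)) := by
    have he : Even (3 * R * u n) := (hReven.mul_left 3).mul_right _
    rw [hurec, Int.odd_sub]
    simp only [← Int.not_even_iff_odd, he]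
    tauto
  have hpair (n : ℤ) : Odd (u n) ∧ Odd (u (n + 1)) := by
    induction n using Int.induction_on with
    | zero => simpa [hu0, hu1] using And.intro hxo hzo
    | succ n ih => exact ⟨ih.2, (hodd _).2 (by simpa using ih.1)⟩
    | pred n ih => exact ⟨(hodd _).1 ih.2, by simpa using ih.1⟩
  exact fun n => (hpair n).1
end

section
/- For every natural number n, (P(2n+1), P(2n+3), 2) is a Markov triple, where P denotes the Pell sequence; that is, P(2n+1)² + P(2n+3)² + 4 = 6·P(2n+1)·P(2n+3). In particular the region numbers of Region 2 of the Markov tree are the odd-indexed Pell numbers. -/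
/-- The Pell sequence: P(0) = 0, P(1) = 1, P(n+2) = 2·P(n+1) + P(n). -/
def pellSeq : ℕ → ℕ
  | 0 => 0
  | 1 => 1
  | n + 2 => 2 * pellSeq (n + 1) + pellSeq n

theorem pellSeq_pos_of_pos : ∀ {n : ℕ}, 0 < n → 0 < pellSeq n
  | 1, _ => by simp [pellSeq]
  | n + 2, _ => by
    have := pellSeq_pos_of_pos (n := n + 1) n.succ_pos
    simp only [pellSeq]
    omega

/-- Cassini's identity for the Pell sequence at even indices. -/
theorem pellSeq_odd_sq (n : ℕ) :
    pellSeq (2 * n + 1) ^ 2 =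
      pellSeq (2 * n) ^ 2 + 2 * pellSeq (2 * n) * pellSeq (2 * n + 1) + 1 := by
  induction n with
  | zero => simp [pellSeq]
  | succ k ih =>
    have h : 2 * (k + 1) = 2 * k + 2 := by ring
    simp only [h, pellSeq]
    linarith

/-- For every natural number n, (P(2n+1), P(2n+3), 2) is a Markov
triple: the region numbers of Region 2 are the odd-indexed Pell numbers. -/
theorem pell_markov_triple (n : ℕ) :
    0 < pellSeq (2 * n + 1) ∧ 0 < pellSeq (2 * n + 3) ∧
    pellSeq (2 * n + 1) ^ 2 + pellSeq (2 * n + 3) ^ 2 + 4 =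
      6 * pellSeq (2 * n + 1) * pellSeq (2 * n + 3) := by
  refine ⟨pellSeq_pos_of_pos (by omega), pellSeq_pos_of_pos (by omega), ?_⟩
  have h := pellSeq_odd_sq n
  simp only [pellSeq]
  linarith
end

section
/- Let (x, R, z) be a Markov triple. Then R is a sum of two integer squares: there exist integers a and b with R = a² + b². In particular every Markov number is the sum of the squares of two integers. -/
/-- A common divisor of the entries of a Markov triple is a unit, by Vieta descent on the sum of
the entries. -/
theorem isUnit_of_dvd_markov_triple (d : ℤ) (n : ℕ) :
    ∀ x y z : ℤ, 0 < x → 0 < y → 0 < z → x ^ 2 + y ^ 2 + z ^ 2 = 3 * x * y * z →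
      x + y + z ≤ n → d ∣ x → d ∣ y → d ∣ z → IsUnit d := by
  induction n with
  | zero => intro x y z hx hy hz _ hn; push_cast at hn; omega
  | succ n ih =>
    have sorted : ∀ x y z : ℤ, 0 < x → 0 < y → 0 < z →
        x ^ 2 + y ^ 2 + z ^ 2 = 3 * x * y * z → x + y + z ≤ n + 1 →
        d ∣ x → d ∣ y → d ∣ z → x ≤ y → y ≤ z → IsUnit d := by
      intro x y z hx hy hz h hn dx dy dz hxy hyz
      by_cases hlt : 3 * x * y - z < z
      · have hpos : 0 < 3 * x * y - z := by
          have hmul : 0 < z * (3 * x * y - z) := by nlinarith [pow_pos hx 2, pow_pos hy 2]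
          exact pos_of_mul_pos_right hmul hz.le
        exact ih x y (3 * x * y - z) hx hy hpos (by linear_combination h) (by linarith) dx dy
          (dvd_sub (dvd_mul_of_dvd_right dy _) dz)
      · have hroots : 0 ≤ (z - y) * (3 * x * y - z - y) :=
          mul_nonneg (by linarith) (by linarith)
        have hx1 : x = 1 := by
          by_contra hne
          have hx2 : 2 ≤ x := by omega
          nlinarith [pow_pos hy 2, mul_le_mul hxy hxy hx.le hy.le,
            mul_le_mul_of_nonneg_right hx2 (sq_nonneg y)]
        exact isUnit_of_dvd_one (hx1 ▸ dx)
    intro x y z hx hy hz h hn dx dy dz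
    push_cast at hn
    rcases le_total x y with hxy | hxy <;> rcases le_total y z with hyz | hyz <;>
      rcases le_total x z with hxz | hxz
    · exact sorted x y z hx hy hz h hn dx dy dz hxy hyz
    · exact sorted x y z hx hy hz h hn dx dy dz hxy hyz
    · exact sorted x z y hx hz hy (by linarith) (by linarith) dx dz dy hxz hyz
    · exact sorted z x y hz hx hy (by linarith) (by linarith) dz dx dy hxz hxy
    · exact sorted y x z hy hx hz (by linarith) (by linarith) dy dx dz hxy hxz
    · exact sorted y z x hy hz hx (by linarith) (by linarith) dy dz dx hyz hxz
    · exact sorted z y x hz hy hx (by linarith) (by linarith) dz dy dx hyz hxy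
    · exact sorted z y x hz hy hx (by linarith) (by linarith) dz dy dx hyz hxy

/-- Two entries of a Markov triple are coprime. -/
theorem isCoprime_of_markov_triple {x y z : ℤ} (hx : 0 < x) (hy : 0 < y) (hz : 0 < z)
    (h : x ^ 2 + y ^ 2 + z ^ 2 = 3 * x * y * z) : IsCoprime x z := by
  refine isCoprime_of_prime_dvd (fun h0 ↦ hx.ne' h0.1) fun p hp dx dz ↦ hp.not_isUnit ?_
  have dy : p ∣ y := by
    refine hp.dvd_of_dvd_pow (n := 2) ?_
    rw [show y ^ 2 = x * (3 * y * z - x) - z * z by linear_combination h]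
    exact dvd_sub (dvd_mul_of_dvd_left dx _) (dvd_mul_of_dvd_left dz _)
  exact isUnit_of_dvd_markov_triple p (x + y + z).toNat x y z hx hy hz h
    (Int.self_le_toNat _) dx dy dz

/-- Every Markov number is a sum of two integer squares. -/
theorem markov_sum_of_two_squares (x R z : ℤ) (hx : 0 < x) (hR : 0 < R) (hz : 0 < z)
    (h : x ^ 2 + R ^ 2 + z ^ 2 = 3 * x * R * z) :
    ∃ a b : ℤ, R = a ^ 2 + b ^ 2 := by
  have hdvd : R ∣ x ^ 2 + z ^ 2 := ⟨3 * x * z - R, by linear_combination h⟩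
  have hsq := ZMod.isSquare_neg_one_of_dvd (Int.natAbs_dvd_natAbs.mpr hdvd)
    (ZMod.isSquare_neg_one_of_eq_sq_add_sq_of_isCoprime rfl
      (isCoprime_of_markov_triple hx hR hz h))
  obtain ⟨a, b, hab⟩ := Nat.eq_sq_add_sq_of_isSquare_mod_neg_one hsq
  refine ⟨a, b, ?_⟩
  rw [← Int.natAbs_of_nonneg hR.le, hab]
  push_cast
  rfl
end
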